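/- Let $a$ be an $n\times n$ integer matrix with $\det a \neq 0$, let $M_0 = \{ y a : y \in \mathbb{Z}^n \}$, and let $N$ be a positive integer with $N\,\mathbb{Z}^n \subseteq M_0$. Let $\tau_1, \tau_2 > N$. Then for every $n\times n$ positive definite real symmetric matrix $Z$ one has $m_{\tau_1}(Z) = m_{\tau_2}(Z)$ and $M_{\tau_1}(Z) = M_{\tau_2}(Z)$. Consequently, the set of positive definite $Z$ that are well rounded with minimum $1$ at temperament $\tau_1$ (i.e., $m_{\tau_1}(Z)=1$ and $M_{\tau_1}(Z)$ spans $\mathbb{R}^n$) equals the corresponding set at temperament $\tau_2$. -/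

import Mathlib

open Matrix
open scoped Classical

/-- The weighted quadratic form `φ_τ(x) Z[x]` with weight `1` on `M0` and `τ²` off `M0`. -/
noncomputable def weightedForm {n : ℕ} (M0 : Set (Fin n → ℤ)) (τ : ℝ)
    (Z : Matrix (Fin n) (Fin n) ℝ) (x : Fin n → ℤ) : ℝ :=
  (if x ∈ M0 then (1 : ℝ) else τ ^ 2) *
    (Matrix.vecMul (fun i => (x i : ℝ)) Z ⬝ᵥ fun i => (x i : ℝ))

/-- `m_τ(Z)`, the arithmetic minimum at temperament `τ`. -/
noncomputable def arithMin {n : ℕ} (M0 : Set (Fin n → ℤ)) (τ : ℝ)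
    (Z : Matrix (Fin n) (Fin n) ℝ) : ℝ :=
  sInf {r : ℝ | ∃ x : Fin n → ℤ, x ≠ 0 ∧ r = weightedForm M0 τ Z x}

/-- `M_τ(Z)`, the set of minimal vectors at temperament `τ`. -/
noncomputable def minVecs {n : ℕ} (M0 : Set (Fin n → ℤ)) (τ : ℝ)
    (Z : Matrix (Fin n) (Fin n) ℝ) : Set (Fin n → ℤ) :=
  {x : Fin n → ℤ | x ≠ 0 ∧ weightedForm M0 τ Z x = arithMin M0 τ Z}

/-- The set of positive definite symmetric `Z` that are well rounded with minimum `1`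
at temperament `τ`. -/
noncomputable def wellRounded {n : ℕ} (M0 : Set (Fin n → ℤ)) (τ : ℝ) :
    Set (Matrix (Fin n) (Fin n) ℝ) :=
  {Z : Matrix (Fin n) (Fin n) ℝ | Z.IsSymm ∧ (∀ v : Fin n → ℝ, v ≠ 0 → 0 < Matrix.vecMul v Z ⬝ᵥ v) ∧
    arithMin M0 τ Z = 1 ∧
    Submodule.span ℝ ((fun x : Fin n → ℤ => fun i => (x i : ℝ)) '' minVecs M0 τ Z) = ⊤}

section Temperament

variable {n : ℕ} {M0 : Set (Fin n → ℤ)} {τ τ' : ℝ} {Z : Matrix (Fin n) (Fin n) ℝ} {x : Fin n → ℤ}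

theorem weightedForm_of_mem (hx : x ∈ M0) :
    weightedForm M0 τ Z x = weightedForm M0 τ' Z x := by
  simp only [weightedForm, if_pos hx]

theorem form_intCast_pos (hZ : ∀ v : Fin n → ℝ, v ≠ 0 → 0 < Matrix.vecMul v Z ⬝ᵥ v)
    (hx : x ≠ 0) :
    0 < Matrix.vecMul (fun i => (x i : ℝ)) Z ⬝ᵥ fun i => (x i : ℝ) := by
  refine hZ _ fun h => hx (funext fun i => ?_)
  simpa using congrFun h i

theorem weightedForm_nonneg (hZ : ∀ v : Fin n → ℝ, v ≠ 0 → 0 < Matrix.vecMul v Z ⬝ᵥ v)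
    (hx : x ≠ 0) : 0 ≤ weightedForm M0 τ Z x := by
  have := form_intCast_pos hZ hx
  unfold weightedForm
  split_ifs <;> positivity

theorem arithMin_le_weightedForm
    (hZ : ∀ v : Fin n → ℝ, v ≠ 0 → 0 < Matrix.vecMul v Z ⬝ᵥ v) (hx : x ≠ 0) :
    arithMin M0 τ Z ≤ weightedForm M0 τ Z x := by
  refine csInf_le ⟨0, ?_⟩ ⟨x, hx, rfl⟩
  rintro _ ⟨y, hy, rfl⟩
  exact weightedForm_nonneg hZ hy

theorem weightedForm_smul_lt {N : ℕ} (hNM : (N : ℤ) • x ∈ M0) (hτ : (N : ℝ) < τ)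
    (hZ : ∀ v : Fin n → ℝ, v ≠ 0 → 0 < Matrix.vecMul v Z ⬝ᵥ v) (hx : x ≠ 0) (hxM : x ∉ M0) :
    weightedForm M0 τ Z ((N : ℤ) • x) < weightedForm M0 τ Z x := by
  have hcast : (fun i => ((((N : ℤ) • x) i : ℤ) : ℝ)) = (N : ℝ) • fun i => (x i : ℝ) := by
    ext i
    simp
  simp only [weightedForm, if_pos hNM, if_neg hxM]
  rw [hcast, Matrix.smul_vecMul, smul_dotProduct, dotProduct_smul, smul_eq_mul, smul_eq_mul,
    one_mul, ← mul_assoc, ← sq]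
  exact mul_lt_mul_of_pos_right (pow_lt_pow_left₀ hτ (Nat.cast_nonneg N) two_ne_zero)
    (form_intCast_pos hZ hx)

/-- Every nonzero vector is weakly dominated by a nonzero vector of `M0`. -/
theorem exists_mem_weightedForm_le {N : ℕ} (hN : 0 < N)
    (hNM : ∀ x : Fin n → ℤ, (N : ℤ) • x ∈ M0) (hτ : (N : ℝ) < τ)
    (hZ : ∀ v : Fin n → ℝ, v ≠ 0 → 0 < Matrix.vecMul v Z ⬝ᵥ v) (hx : x ≠ 0) :
    ∃ y ∈ M0, y ≠ 0 ∧ weightedForm M0 τ Z y ≤ weightedForm M0 τ Z x := by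
  by_cases hxM : x ∈ M0
  · exact ⟨x, hxM, hx, le_rfl⟩
  · exact ⟨(N : ℤ) • x, hNM x, smul_ne_zero (by exact_mod_cast hN.ne') hx,
      (weightedForm_smul_lt (hNM x) hτ hZ hx hxM).le⟩

theorem arithMin_eq_arithMin {N : ℕ} (hN : 0 < N)
    (hNM : ∀ x : Fin n → ℤ, (N : ℤ) • x ∈ M0) (hτ : (N : ℝ) < τ) (hτ' : (N : ℝ) < τ')
    (hZ : ∀ v : Fin n → ℝ, v ≠ 0 → 0 < Matrix.vecMul v Z ⬝ᵥ v) :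
    arithMin M0 τ Z = arithMin M0 τ' Z := by
  apply csInf_eq_csInf_of_forall_exists_le
  · rintro _ ⟨x, hx, rfl⟩
    obtain ⟨y, hyM, hy, hle⟩ := exists_mem_weightedForm_le hN hNM hτ hZ hx
    exact ⟨_, ⟨y, hy, rfl⟩, (weightedForm_of_mem hyM).trans_le hle⟩
  · rintro _ ⟨x, hx, rfl⟩
    obtain ⟨y, hyM, hy, hle⟩ := exists_mem_weightedForm_le hN hNM hτ' hZ hx
    exact ⟨_, ⟨y, hy, rfl⟩, (weightedForm_of_mem hyM).trans_le hle⟩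

theorem mem_of_mem_minVecs {N : ℕ} (hN : 0 < N)
    (hNM : ∀ x : Fin n → ℤ, (N : ℤ) • x ∈ M0) (hτ : (N : ℝ) < τ)
    (hZ : ∀ v : Fin n → ℝ, v ≠ 0 → 0 < Matrix.vecMul v Z ⬝ᵥ v) (hx : x ∈ minVecs M0 τ Z) :
    x ∈ M0 := by
  by_contra hxM
  have hNx : (N : ℤ) • x ≠ 0 := smul_ne_zero (by exact_mod_cast hN.ne') hx.1
  exact absurd (arithMin_le_weightedForm hZ hNx)
    (not_le.mpr ((weightedForm_smul_lt (hNM x) hτ hZ hx.1 hxM).trans_eq hx.2))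

theorem minVecs_subset_minVecs {N : ℕ} (hN : 0 < N)
    (hNM : ∀ x : Fin n → ℤ, (N : ℤ) • x ∈ M0) (hτ : (N : ℝ) < τ) (hτ' : (N : ℝ) < τ')
    (hZ : ∀ v : Fin n → ℝ, v ≠ 0 → 0 < Matrix.vecMul v Z ⬝ᵥ v) :
    minVecs M0 τ Z ⊆ minVecs M0 τ' Z := fun _ hx =>
  ⟨hx.1, (weightedForm_of_mem (mem_of_mem_minVecs hN hNM hτ hZ hx)).trans
    (hx.2.trans (arithMin_eq_arithMin hN hNM hτ hτ' hZ))⟩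

end Temperament

theorem stmt3 {n : ℕ} (a : Matrix (Fin n) (Fin n) ℤ) (ha : a.det ≠ 0)
    (M0 : Set (Fin n → ℤ))
    (hM0 : M0 = Set.range fun y : Fin n → ℤ => Matrix.vecMul y a)
    (N : ℕ) (hN : 0 < N) (hNM : ∀ x : Fin n → ℤ, (N : ℤ) • x ∈ M0)
    (τ₁ τ₂ : ℝ) (hτ₁ : (N : ℝ) < τ₁) (hτ₂ : (N : ℝ) < τ₂) :
    (∀ Z : Matrix (Fin n) (Fin n) ℝ, Z.IsSymm →
      (∀ v : Fin n → ℝ, v ≠ 0 → 0 < Matrix.vecMul v Z ⬝ᵥ v) →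
      arithMin M0 τ₁ Z = arithMin M0 τ₂ Z ∧ minVecs M0 τ₁ Z = minVecs M0 τ₂ Z) ∧
    wellRounded M0 τ₁ = wellRounded M0 τ₂ := by
  have key : ∀ Z : Matrix (Fin n) (Fin n) ℝ,
      (∀ v : Fin n → ℝ, v ≠ 0 → 0 < Matrix.vecMul v Z ⬝ᵥ v) →
      arithMin M0 τ₁ Z = arithMin M0 τ₂ Z ∧ minVecs M0 τ₁ Z = minVecs M0 τ₂ Z := fun Z hZ =>
    ⟨arithMin_eq_arithMin hN hNM hτ₁ hτ₂ hZ,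
      (minVecs_subset_minVecs hN hNM hτ₁ hτ₂ hZ).antisymm
        (minVecs_subset_minVecs hN hNM hτ₂ hτ₁ hZ)⟩
  refine ⟨fun Z _ hZ => key Z hZ, Set.ext fun Z => and_congr_right fun _ =>
    and_congr_right fun hZ => ?_⟩
  rw [(key Z hZ).1, (key Z hZ).2]
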